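/- Pieri-type rule for factorial Schur polynomials: Let n ≥ 1 and let μ be a partition with at most n parts. Then s_{(1)}(x|a)·s_μ(x|a) = s_{(1)}(a_μ|a)·s_μ(x|a) + Σ_{ρ} s_ρ(x|a), where the sum is over all partitions ρ with at most n parts such that μ → ρ, and s_{(1)}(a_μ|a) = Σ_{i=1}^n (a_{μ_i+n−i+1} − a_i). This is an identity in ℤ[a_i : i ∈ ℤ][x_1,…,x_n]. -/

import Mathlib

open scoped BigOperators

namespace FactorialLR

/-- A filling of the cell set `s` with entries in `Fin n` (`0`-based, representing the
`1`-based entries `{1,…,n}`) is semistandard if it weakly increases along rows and strictly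
increases down columns. -/
def IsSsyt {n : ℕ} (s : Finset (ℕ × ℕ)) (T : s → Fin n) : Prop :=
  (∀ c c' : s, (c : ℕ × ℕ).1 = (c' : ℕ × ℕ).1 → (c : ℕ × ℕ).2 ≤ (c' : ℕ × ℕ).2 → T c ≤ T c') ∧
  (∀ c c' : s, (c : ℕ × ℕ).1 < (c' : ℕ × ℕ).1 → (c : ℕ × ℕ).2 = (c' : ℕ × ℕ).2 → T c < T c')

/-- The factorial Schur-type polynomial attached to a (possibly skew) cell set `s`:
`Σ_T ∏_{α ∈ s} (x_{T(α)} − a_{T(α)+c(α)})`, where `T` runs over semistandard fillings of `s`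
with entries in `{1,…,n}` (stored `0`-based) and `c(α) = j − i` is the content of `α = (i,j)`.
Taking `a = 0` gives the ordinary Schur polynomial. -/
noncomputable def sgen {A : Type} [CommRing A] (n : ℕ) (s : Finset (ℕ × ℕ))
    (x : Fin n → A) (a : ℤ → A) : A :=
  ∑ᶠ T ∈ {T : s → Fin n | IsSsyt s T},
    ∏ c : s, (x (T c) - a ((T c : ℤ) + 1 + ((c : ℕ × ℕ).2 : ℤ) - ((c : ℕ × ℕ).1 : ℤ)))

/-- The `n`-tuple `a_ρ = (a_{ρ_1+n}, a_{ρ_2+n-1}, …, a_{ρ_n+1})`; the `i`-th entry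
(`0`-based `i`) is `a_{ρ_{i+1}+n-(i+1)+1}`. -/
noncomputable def subA {A : Type} [CommRing A] (n : ℕ) (a : ℤ → A) (ρ : YoungDiagram) :
    Fin n → A :=
  fun i => a ((ρ.rowLen i : ℤ) + (n : ℤ) - (i : ℤ))

/-- `μ → ν` : `ν` is obtained from `μ` by adding a single cell. -/
def Covers (μ ν : YoungDiagram) : Prop :=
  μ ≤ ν ∧ ν.card = μ.card + 1

/-- The one-cell Young diagram `(1)`. -/
def oneBox : YoungDiagram :=
  ⟨{(0, 0)}, by
    intro a b hba ha
    simp only [Finset.coe_singleton, Set.mem_singleton_iff] at ha ⊢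
    subst ha
    exact le_antisymm hba bot_le⟩


/-- The set of cells of the shape with row lengths `l`. -/
def cellsOf {n : ℕ} (l : Fin n → ℕ) : Finset (ℕ × ℕ) :=
  (Finset.univ : Finset (Fin n)).biUnion fun i => (Finset.range (l i)).image fun j => ((i : ℕ), j)

theorem mem_cellsOf {n : ℕ} (l : Fin n → ℕ) (c : ℕ × ℕ) :
    c ∈ cellsOf l ↔ ∃ h : c.1 < n, c.2 < l ⟨c.1, h⟩ := by
  simp only [cellsOf, Finset.mem_biUnion, Finset.mem_univ, true_and, Finset.mem_image,
    Finset.mem_range]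
  constructor
  · rintro ⟨i, j, hj, rfl⟩
    exact ⟨i.2, hj⟩
  · rintro ⟨h, hc⟩
    exact ⟨⟨c.1, h⟩, c.2, hc, rfl⟩

theorem mk_mem_cellsOf {n : ℕ} (l : Fin n → ℕ) (i : Fin n) (j : ℕ) :
    ((i : ℕ), j) ∈ cellsOf l ↔ j < l i := by
  rw [mem_cellsOf]
  exact ⟨fun ⟨_, h⟩ => h, fun h => ⟨i.2, h⟩⟩

theorem cellsOf_inj {n : ℕ} {l k : Fin n → ℕ} (h : cellsOf l = cellsOf k) : l = k := by
  funext i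
  have h1 : ∀ j, j < l i ↔ j < k i := fun j => by
    rw [← mk_mem_cellsOf, ← mk_mem_cellsOf, h]
  have h2 := h1 (l i)
  have h3 := h1 (k i)
  omega

/-- Interlacing sequences. -/
def box {n : ℕ} (l : Fin (n + 1) → ℕ) : Finset (Fin n → ℕ) :=
  Fintype.piFinset fun i : Fin n => Finset.Icc (l i.succ) (l i.castSucc)

theorem mem_box {n : ℕ} (l : Fin (n + 1) → ℕ) (k : Fin n → ℕ) :
    k ∈ box l ↔ ∀ i : Fin n, l i.succ ≤ k i ∧ k i ≤ l i.castSucc := by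
  simp [box, Fintype.mem_piFinset]

def up {n : ℕ} (l : Fin n → ℕ) (i : Fin n) : Fin n → ℕ := fun j => if j = i then l j + 1 else l j
def down {n : ℕ} (l : Fin n → ℕ) (i : Fin n) : Fin n → ℕ := fun j => if j = i then l j - 1 else l j

theorem cellsOf_up {n : ℕ} (l : Fin n → ℕ) (i : Fin n) :
    cellsOf (up l i) = insert ((i : ℕ), l i) (cellsOf l) := by
  ext ⟨r, c⟩
  rw [Finset.mem_insert]
  by_cases hr : r < n
  · have h1 := mk_mem_cellsOf (up l i) ⟨r, hr⟩ c
    have h2 := mk_mem_cellsOf l ⟨r, hr⟩ c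
    simp only at h1 h2
    rw [h1, h2]
    by_cases h : (⟨r, hr⟩ : Fin n) = i
    · subst h; simp [up]; omega
    · have : r ≠ (i : ℕ) := fun e => h (Fin.ext e)
      simp [up, h, this]
  · have : r ≠ (i : ℕ) := by omega
    simp [mem_cellsOf, hr, this]

theorem up_down {n : ℕ} (l : Fin n → ℕ) (i : Fin n) (h : 0 < l i) : up (down l i) i = l := by
  funext j
  simp only [up, down]
  split_ifs with hj
  · subst hj; omega
  · rfl

theorem down_up {n : ℕ} (l : Fin n → ℕ) (i : Fin n) : down (up l i) i = l := by
  funext j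
  simp only [up, down]
  split_ifs with hj
  · omega
  · rfl

theorem up_same {n : ℕ} (l : Fin n → ℕ) (i : Fin n) : up l i i = l i + 1 := by simp [up]
theorem up_ne {n : ℕ} (l : Fin n → ℕ) {i j : Fin n} (h : j ≠ i) : up l i j = l j := by simp [up, h]
theorem down_same {n : ℕ} (l : Fin n → ℕ) (i : Fin n) : down l i i = l i - 1 := by simp [down]
theorem down_ne {n : ℕ} (l : Fin n → ℕ) {i j : Fin n} (h : j ≠ i) : down l i j = l j := by
  simp [down, h]

section algebra
variable {A : Type} [CommRing A]

noncomputable def wt {n : ℕ} (y : A) (a : ℤ → A) (l : Fin (n + 1) → ℕ) (k : Fin n → ℕ) : A :=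
  ∏ c ∈ cellsOf l \ cellsOf k, (y - a ((n : ℤ) + 1 + (c.2 : ℤ) - (c.1 : ℤ)))

noncomputable def S (a : ℤ → A) : (n : ℕ) → (Fin n → A) → (Fin n → ℕ) → A
  | 0, _, _ => 1
  | n + 1, x, l => ∑ k ∈ box l, wt (x (Fin.last n)) a l k * S a n (fun i => x i.castSucc) k

theorem S_zero_of_lt (a : ℤ → A) {n : ℕ} (x : Fin n → A) (l : Fin n → ℕ) (i j : Fin n)
    (hij : (j : ℕ) = i + 1) (h : l i < l j) : S a n x l = 0 := by
  cases n with
  | zero => exact i.elim0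
  | succ n =>
    rw [S]
    apply Finset.sum_eq_zero
    intro k hk
    exfalso
    rw [mem_box] at hk
    have hi : (i : ℕ) < n := by omega
    have := hk ⟨i, hi⟩
    have e1 : (⟨i, hi⟩ : Fin n).castSucc = i := rfl
    have e2 : (⟨i, hi⟩ : Fin n).succ = j := by ext; simp [hij]
    rw [e1, e2] at this
    omega

theorem wt_up_up {n : ℕ} (y : A) (a : ℤ → A) (l : Fin (n + 1) → ℕ) (k : Fin n → ℕ) (i : Fin n)
    (h : k i = l i.castSucc) : wt y a (up l i.castSucc) (up k i) = wt y a l k := by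
  unfold wt
  congr 1
  rw [cellsOf_up, cellsOf_up, h]
  have h1 := mk_mem_cellsOf l i.castSucc (l i.castSucc)
  simp only [Fin.val_castSucc] at h1 ⊢
  ext c
  simp only [Finset.mem_sdiff, Finset.mem_insert]
  have : c = ((i : ℕ), l i.castSucc) → c ∉ cellsOf l := by rintro rfl; simp [h1]
  tauto

theorem wt_up {n : ℕ} (y : A) (a : ℤ → A) (l : Fin (n + 1) → ℕ) (k : Fin n → ℕ)
    (i : Fin (n + 1)) (h : ∀ j : Fin n, j.castSucc = i → k j ≤ l i) :
    wt y a (up l i) k = (y - a ((l i : ℤ) + n + 1 - i)) * wt y a l k := by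
  unfold wt
  have hk : ((i : ℕ), l i) ∉ cellsOf k := by
    rw [mem_cellsOf]
    rintro ⟨h1, h2⟩
    have := h ⟨i, h1⟩ (by ext; simp)
    simp only at h2
    omega
  rw [cellsOf_up, Finset.insert_sdiff_of_notMem _ hk, Finset.prod_insert]
  · congr 3
    ring
  · simp [mk_mem_cellsOf]

theorem wt_down {n : ℕ} (y : A) (a : ℤ → A) (l : Fin (n + 1) → ℕ) (k : Fin n → ℕ)
    (i : Fin n) (h : k i < l i.castSucc) :
    wt y a l k = (y - a (((up k i) i : ℤ) + n - i)) * wt y a l (up k i) := by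
  unfold wt
  have h1 : ((i : ℕ), k i) ∈ cellsOf l := (mk_mem_cellsOf l i.castSucc (k i)).2 h
  have h2 := mk_mem_cellsOf k i (k i)
  have : cellsOf l \ cellsOf k = insert ((i : ℕ), k i) (cellsOf l \ cellsOf (up k i)) := by
    rw [cellsOf_up]
    ext c
    simp only [Finset.mem_sdiff, Finset.mem_insert]
    have : c = ((i : ℕ), k i) → c ∈ cellsOf l ∧ c ∉ cellsOf k := by
      rintro rfl; exact ⟨h1, by simp [h2]⟩
    tauto
  rw [this, Finset.prod_insert]
  · congr 3
    rw [up_same]; push_cast; ring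
  · simp [cellsOf_up]

theorem box_antitone {n : ℕ} {l : Fin (n + 1) → ℕ} {k : Fin n → ℕ} (hk : k ∈ box l) :
    Antitone k := by
  rw [mem_box] at hk
  cases n with
  | zero => intro i; exact i.elim0
  | succ n =>
    rw [Fin.antitone_iff_succ_le]
    intro i
    have h1 := (hk i.succ).2
    have h2 := (hk i.castSucc).1
    rw [← Fin.succ_castSucc] at h1
    omega

/-- common part -/
noncomputable def Tsum (a : ℤ → A) {n : ℕ} (y : A) (f : (Fin n → ℕ) → A) (l : Fin (n + 1) → ℕ)
    (i : Fin n) : A :=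
  ∑ k ∈ (box l).filter (fun k => k i = l i.castSucc), wt y a l k * f (up k i)

theorem Lsum_eq (a : ℤ → A) {n : ℕ} (y : A) (f : (Fin n → ℕ) → A) (l : Fin (n + 1) → ℕ)
    (i : Fin n) :
    ∑ k ∈ box l, wt y a l k * f (up k i) = Tsum a y f l i +
      ∑ k ∈ box l, if l i.succ < k i then (y - a ((k i : ℤ) + n - i)) * wt y a l k * f k else 0 := by
  rw [← Finset.sum_filter_add_sum_filter_not (box l) (fun k => k i = l i.castSucc), Tsum]
  congr 1
  rw [← Finset.sum_filter]
  refine Finset.sum_nbij' (fun k => up k i) (fun k => down k i) ?_ ?_ ?_ ?_ ?_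
  · intro k hk
    simp only [Finset.mem_filter, mem_box] at hk ⊢
    obtain ⟨hk, hi⟩ := hk
    refine ⟨fun j => ?_, ?_⟩
    · have := hk j
      by_cases hj : j = i
      · subst hj; rw [up_same]; omega
      · rw [up_ne _ hj]; exact this
    · have := hk i
      rw [up_same]; omega
  · intro k hk
    simp only [Finset.mem_filter, mem_box] at hk ⊢
    obtain ⟨hk, hi⟩ := hk
    refine ⟨fun j => ?_, ?_⟩
    · have := hk j
      by_cases hj : j = i
      · subst hj; rw [down_same]; omega
      · rw [down_ne _ hj]; exact this
    · have := hk i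
      rw [down_same]; omega
  · intro k hk; exact down_up k i
  · intro k hk
    simp only [Finset.mem_filter, mem_box] at hk
    exact up_down k i (by omega)
  · intro k hk
    simp only [Finset.mem_filter, mem_box] at hk
    have := hk.1 i
    rw [wt_down y a l k i (by omega)]

/-- uncommon part -/
noncomputable def Usum (a : ℤ → A) {n : ℕ} (y : A) (f : (Fin n → ℕ) → A) (l : Fin (n + 1) → ℕ)
    (i : Fin (n + 1)) : A :=
  ∑ k ∈ (box l).filter (fun k => ∀ j : Fin n, j.succ = i → l i < k j),
    (y - a ((l i : ℤ) + n + 1 - i)) * wt y a l k * f k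

theorem Rsum_aux (a : ℤ → A) {n : ℕ} (y : A) (f : (Fin n → ℕ) → A) (l : Fin (n + 1) → ℕ)
    (i : Fin (n + 1)) :
    ∑ k ∈ (box (up l i)).filter (fun k => ∀ j : Fin n, j.castSucc = i → k j ≤ l i),
      wt y a (up l i) k * f k = Usum a y f l i := by
  rw [Usum]
  apply Finset.sum_congr
  · ext k
    simp only [Finset.mem_filter, mem_box]
    constructor
    · rintro ⟨h1, h2⟩
      refine ⟨fun j => ?_, fun j hj => ?_⟩
      · have h3 := h1 j
        have h4 := h2 j
        by_cases e1 : j.castSucc = i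
        · have e2 : j.succ ≠ i := by rintro rfl; simp [Fin.ext_iff] at e1
          rw [up_ne _ e2] at h3
          have := h4 e1
          rw [e1]; omega
        · rw [up_ne _ e1] at h3
          by_cases e2 : j.succ = i
          · rw [e2, up_same] at h3; rw [e2]; omega
          · rwa [up_ne _ e2] at h3
      · have h3 := h1 j
        rw [hj, up_same] at h3
        omega
    · rintro ⟨h1, h2⟩
      refine ⟨fun j => ?_, fun j hj => by have := h1 j; rw [hj] at this; exact this.2⟩
      have h3 := h1 j
      have h4 := h2 j
      by_cases e1 : j.castSucc = i
      · have e2 : j.succ ≠ i := by rintro rfl; simp [Fin.ext_iff] at e1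
        rw [up_ne _ e2, e1, up_same]
        rw [e1] at h3; omega
      · rw [up_ne _ e1]
        by_cases e2 : j.succ = i
        · have := h4 e2
          rw [e2, up_same]; rw [e2] at h3; omega
        · rwa [up_ne _ e2]
  · intro k hk
    simp only [Finset.mem_filter, mem_box] at hk
    rw [wt_up]
    intro j hj
    have := hk.1 j
    rw [hj] at this
    exact this.2

theorem Rsum_last (a : ℤ → A) {n : ℕ} (y : A) (f : (Fin n → ℕ) → A) (l : Fin (n + 1) → ℕ) :
    ∑ k ∈ box (up l (Fin.last n)), wt y a (up l (Fin.last n)) k * f k =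
      Usum a y f l (Fin.last n) := by
  rw [← Rsum_aux, Finset.filter_true_of_mem]
  intro k _ j hj
  exact absurd hj (Fin.castSucc_ne_last j)

theorem Rsum_castSucc (a : ℤ → A) {n : ℕ} (y : A) (f : (Fin n → ℕ) → A) (l : Fin (n + 1) → ℕ)
    (hl : Antitone l) (i : Fin n)
    (hf : ∀ k : Fin n → ℕ, ∀ i j : Fin n, (j : ℕ) = i + 1 → k i < k j → f k = 0) :
    ∑ k ∈ box (up l i.castSucc), wt y a (up l i.castSucc) k * f k =
      Tsum a y f l i + Usum a y f l i.castSucc := by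
  rw [← Rsum_aux, ← Finset.sum_filter_not_add_sum_filter (box (up l i.castSucc))
    (fun k => ∀ j : Fin n, j.castSucc = i.castSucc → k j ≤ l i.castSucc)]
  congr 1
  rw [Tsum]
  have hsub : (((box l).filter (fun k => k i = l i.castSucc)).filter
      (fun k => up k i ∈ box (up l i.castSucc))) ⊆
      (box l).filter (fun k => k i = l i.castSucc) := Finset.filter_subset _ _
  rw [← Finset.sum_subset hsub]
  · symm
    refine Finset.sum_nbij' (fun k => up k i) (fun k => down k i) ?_ ?_ ?_ ?_ ?_
    · intro k hk
      simp only [Finset.mem_filter] at hk ⊢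
      refine ⟨hk.2, fun h => ?_⟩
      have := h i rfl
      rw [up_same] at this
      omega
    · intro k hk
      simp only [Finset.mem_filter] at hk ⊢
      obtain ⟨h1, h2⟩ := hk
      have h2' : l i.castSucc < k i := by
        by_contra hh
        apply h2
        intro j hj
        have : j = i := Fin.castSucc_injective _ hj
        subst this; omega
      rw [up_down k i (by omega)]
      refine ⟨⟨?_, ?_⟩, h1⟩
      · rw [mem_box] at h1 ⊢
        intro j
        have h3 := h1 j
        by_cases hj : j = i
        · subst hj
          have e2 : j.succ ≠ j.castSucc := by simp [Fin.ext_iff]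
          rw [up_ne _ e2, up_same] at h3
          have h5 := hl (Fin.castSucc_le_succ j)
          rw [down_same]; omega
        · have e1 : j.castSucc ≠ i.castSucc := fun e => hj (Fin.castSucc_injective _ e)
          rw [up_ne _ e1] at h3
          rw [down_ne _ hj]
          by_cases e2 : j.succ = i.castSucc
          · rw [e2, up_same] at h3; rw [e2]; omega
          · rwa [up_ne _ e2] at h3
      · rw [mem_box] at h1
        have h3 := h1 i
        rw [up_same] at h3
        rw [down_same]; omega
    · intro k _; exact down_up k i
    · intro k hk
      simp only [Finset.mem_filter] at hk
      obtain ⟨h1, h2⟩ := hk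
      apply up_down
      by_contra hh
      apply h2
      intro j hj
      have : j = i := Fin.castSucc_injective _ hj
      subst this; omega
    · intro k hk
      simp only [Finset.mem_filter] at hk
      rw [wt_up_up _ _ _ _ _ hk.1.2]
  · intro k hk hk2
    simp only [Finset.mem_filter] at hk hk2
    have h2 : up k i ∉ box (up l i.castSucc) := fun h => hk2 ⟨hk, h⟩
    obtain ⟨h1, h3⟩ := hk
    rw [mem_box] at h1 h2
    push Not at h2
    obtain ⟨j, hj⟩ := h2
    by_cases e : j.succ = i.castSucc
    · have e1 : (i : ℕ) = j + 1 := by simpa [Fin.ext_iff] using e.symm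
      have hji : j ≠ i := by intro h; rw [h] at e1; omega
      by_cases hlt : up k i j < up k i i
      · rw [hf _ j i e1 hlt, mul_zero]
      · exfalso
        rw [up_same, up_ne _ hji] at hlt
        rw [e, up_same, up_ne _ hji, up_ne] at hj
        · have := h1 j
          have := hj (by omega)
          omega
        · exact fun e => hji (Fin.castSucc_injective _ e)
    · exfalso
      have h4 := h1 j
      rw [up_ne _ e] at hj
      by_cases hji : j = i
      · subst hji
        rw [up_same, up_same] at hj
        have := hj (by omega)
        omega
      · rw [up_ne _ hji, up_ne] at hj
        · have := hj (by omega)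
          omega
        · exact fun e => hji (Fin.castSucc_injective _ e)

theorem pieri_S (a : ℤ → A) : ∀ (n : ℕ) (x : Fin n → A) (l : Fin n → ℕ), Antitone l →
    (∑ i : Fin n, (x i - a ((l i : ℤ) + n - i))) * S a n x l = ∑ i : Fin n, S a n x (up l i) := by
  intro n
  induction n with
  | zero => intro x l _; simp
  | succ n ih =>
    intro x l hl
    set y := x (Fin.last n) with hy
    set f := S a n (fun i => x i.castSucc) with hfdef
    have hf : ∀ k : Fin n → ℕ, ∀ i j : Fin n, (j : ℕ) = i + 1 → k i < k j → f k = 0 :=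
      fun k i j => S_zero_of_lt a _ k i j
    have hR : ∑ i : Fin (n + 1), S a (n + 1) x (up l i) =
        ∑ i : Fin n, Tsum a y f l i + ∑ i : Fin (n + 1), Usum a y f l i := by
      rw [Fin.sum_univ_castSucc, Fin.sum_univ_castSucc, ← add_assoc, ← Finset.sum_add_distrib]
      congr 1
      · exact Finset.sum_congr rfl fun i _ => Rsum_castSucc a y f l hl i hf
      · exact Rsum_last a y f l
    have hU0 : Usum a y f l 0 = ∑ k ∈ box l, (y - a ((l 0 : ℤ) + n + 1)) * wt y a l k * f k := by
      rw [Usum, Finset.filter_true_of_mem]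
      · simp
      · intro k _ j hj
        exact absurd hj (Fin.succ_ne_zero j)
    have hUs : ∀ i : Fin n, Usum a y f l i.succ = ∑ k ∈ box l, if l i.succ < k i then
        (y - a ((l i.succ : ℤ) + n - i)) * wt y a l k * f k else 0 := by
      intro i
      rw [Usum, ← Finset.sum_filter]
      apply Finset.sum_congr
      · ext k
        simp only [Finset.mem_filter, Fin.succ_inj, forall_eq]
      · intro k _
        congr 4
        simp
    have hL : ∀ k ∈ box l, (∑ i : Fin (n + 1), (x i - a ((l i : ℤ) + (n + 1 : ℕ) - i))) * f k =
        ∑ i : Fin n, f (up k i) + ((y - a ((l 0 : ℤ) + n + 1)) +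
          ∑ i : Fin n, (a ((k i : ℤ) + n - i) - a ((l i.succ : ℤ) + n - i))) * f k := by
      intro k hk
      rw [← ih _ k (box_antitone hk), ← hfdef, ← add_mul]
      congr 1
      simp only [Finset.sum_sub_distrib]
      rw [Fin.sum_univ_castSucc (f := x), Fin.sum_univ_succ]
      have : ∀ i : Fin n, a ((l i.succ : ℤ) + (n + 1 : ℕ) - (i.succ : ℕ)) =
          a ((l i.succ : ℤ) + n - i) := by
        intro i; congr 1; simp; ring
      simp only [this]
      have e0 : (l 0 : ℤ) + (n + 1 : ℕ) - ((0 : Fin (n + 1)) : ℕ) = (l 0 : ℤ) + n + 1 := by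
        simp [add_assoc]
      rw [e0]
      ring
    rw [hR, Fin.sum_univ_succ (f := Usum a y f l), hU0, Finset.sum_congr rfl fun i _ => hUs i]
    have hS : S a (n + 1) x l = ∑ k ∈ box l, wt y a l k * f k := rfl
    rw [hS, Finset.mul_sum]
    have : ∀ k ∈ box l, (∑ i : Fin (n + 1), (x i - a ((l i : ℤ) + (n + 1 : ℕ) - i))) *
        (wt y a l k * f k) = ∑ i : Fin n, wt y a l k * f (up k i) +
          ((y - a ((l 0 : ℤ) + n + 1)) +
          ∑ i : Fin n, (a ((k i : ℤ) + n - i) - a ((l i.succ : ℤ) + n - i))) *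
            (wt y a l k * f k) := by
      intro k hk
      rw [mul_left_comm, hL k hk, ← Finset.mul_sum]
      ring
    rw [Finset.sum_congr rfl this, Finset.sum_add_distrib, Finset.sum_comm,
      Finset.sum_congr rfl fun i _ => Lsum_eq a y f l i, Finset.sum_add_distrib, add_assoc]
    congr 1
    rw [Finset.sum_comm, Finset.sum_comm (s := Finset.univ) (t := box l),
      ← Finset.sum_add_distrib, ← Finset.sum_add_distrib]
    apply Finset.sum_congr rfl
    intro k hk
    rw [mem_box] at hk
    rw [add_mul, Finset.sum_mul, ← add_assoc, add_comm (Finset.sum _ _), add_assoc,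
      ← Finset.sum_add_distrib]
    congr 1
    · ring
    · apply Finset.sum_congr rfl
      intro i _
      have := hk i
      split_ifs with h
      · ring
      · have : k i = l i.succ := by omega
        rw [this]; ring

end algebra

section tableaux
variable {A : Type} [CommRing A]

open Classical in
theorem sgen_eq_sum (n : ℕ) (s : Finset (ℕ × ℕ)) (x : Fin n → A) (a : ℤ → A) :
    sgen n s x a = ∑ T ∈ (Finset.univ : Finset (s → Fin n)).filter (fun T => IsSsyt s T),
      ∏ c : s, (x (T c) - a ((T c : ℤ) + 1 + ((c : ℕ × ℕ).2 : ℤ) - ((c : ℕ × ℕ).1 : ℤ))) := by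
  rw [sgen, ← finsum_mem_coe_finset]
  simp

/-- Extend a filling by the largest entry. -/
def extT {n : ℕ} (s t : Finset (ℕ × ℕ)) (T : t → Fin n) : s → Fin (n + 1) :=
  fun c => if h : (c : ℕ × ℕ) ∈ t then (T ⟨c, h⟩).castSucc else Fin.last n

theorem extT_mem {n : ℕ} {s t : Finset (ℕ × ℕ)} (T : t → Fin n) (c : s) (h : (c : ℕ × ℕ) ∈ t) :
    extT s t T c = (T ⟨c, h⟩).castSucc := by simp [extT, h]

theorem extT_not_mem {n : ℕ} {s t : Finset (ℕ × ℕ)} (T : t → Fin n) (c : s)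
    (h : (c : ℕ × ℕ) ∉ t) : extT s t T c = Fin.last n := by simp [extT, h]

theorem extT_eq_last_iff {n : ℕ} {s t : Finset (ℕ × ℕ)} (T : t → Fin n) (c : s) :
    extT s t T c = Fin.last n ↔ (c : ℕ × ℕ) ∉ t := by
  by_cases h : (c : ℕ × ℕ) ∈ t
  · rw [extT_mem T c h]; simp [h, Fin.castSucc_ne_last]
  · simp [extT_not_mem T c h, h]

theorem cellsOf_subset {n : ℕ} {l : Fin (n + 1) → ℕ} {k : Fin n → ℕ} (hk : k ∈ box l) :
    cellsOf k ⊆ cellsOf l := by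
  intro c hc
  rw [mem_cellsOf] at hc ⊢
  obtain ⟨h, hc⟩ := hc
  rw [mem_box] at hk
  have := (hk ⟨c.1, h⟩).2
  exact ⟨by omega, lt_of_lt_of_le hc this⟩

theorem mem_cellsOf_of_above {n : ℕ} {l : Fin (n + 1) → ℕ} (hl : Antitone l) {k : Fin n → ℕ}
    (hk : k ∈ box l) {c c' : ℕ × ℕ} (hc' : c' ∈ cellsOf l) (h1 : c.1 < c'.1) (h2 : c.2 = c'.2) :
    c ∈ cellsOf k := by
  rw [mem_cellsOf] at hc' ⊢
  obtain ⟨h, hc'⟩ := hc'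
  have hcn : c.1 < n := by omega
  refine ⟨hcn, ?_⟩
  rw [mem_box] at hk
  have h3 := (hk ⟨c.1, hcn⟩).1
  have h4 : l ⟨c'.1, h⟩ ≤ l (Fin.succ ⟨c.1, hcn⟩) := hl (by
    rw [Fin.le_def]; simp; omega)
  omega

theorem isSsyt_extT {n : ℕ} {l : Fin (n + 1) → ℕ} (hl : Antitone l) {k : Fin n → ℕ}
    (hk : k ∈ box l) (T : cellsOf k → Fin n) (hT : IsSsyt (cellsOf k) T) :
    IsSsyt (cellsOf l) (extT (cellsOf l) (cellsOf k) T) := by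
  constructor
  · intro c c' h1 h2
    by_cases h : (c' : ℕ × ℕ) ∈ cellsOf k
    · have hc : (c : ℕ × ℕ) ∈ cellsOf k := by
        rw [mem_cellsOf] at h ⊢
        obtain ⟨h3, h4⟩ := h
        refine ⟨by omega, ?_⟩
        simp only [h1]
        omega
      rw [extT_mem T c hc, extT_mem T c' h, Fin.castSucc_le_castSucc_iff]
      exact hT.1 _ _ h1 h2
    · rw [extT_not_mem T c' h]
      exact Fin.le_last _
  · intro c c' h1 h2
    have hc := mem_cellsOf_of_above hl hk c'.2 h1 h2
    rw [extT_mem T c hc]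
    by_cases h : (c' : ℕ × ℕ) ∈ cellsOf k
    · rw [extT_mem T c' h, Fin.castSucc_lt_castSucc_iff]
      exact hT.2 _ _ h1 h2
    · rw [extT_not_mem T c' h]
      exact Fin.castSucc_lt_last _

theorem exists_cut (m : ℕ) (p : ℕ → Prop) (hp : ∀ i j, i ≤ j → j < m → p j → p i) :
    ∃ k ≤ m, ∀ j < m, (p j ↔ j < k) := by
  induction m with
  | zero => exact ⟨0, le_rfl, by simp⟩
  | succ m ih =>
    obtain ⟨k, hk, h⟩ := ih fun i j h1 h2 => hp i j h1 (by omega)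
    by_cases hm : p m
    · refine ⟨m + 1, le_rfl, fun j hj => ⟨fun _ => hj, fun _ => hp j m (by omega) (by omega) hm⟩⟩
    · refine ⟨k, by omega, fun j hj => ?_⟩
      by_cases hjm : j < m
      · exact h j hjm
      · have : j = m := by omega
        subst this
        exact ⟨fun h => absurd h hm, fun h => by omega⟩

theorem ssyt_row_le {n : ℕ} {l : Fin n → ℕ} (hl : Antitone l) (T : cellsOf l → Fin n)
    (hT : IsSsyt (cellsOf l) T) : ∀ (i j : ℕ) (h : (i, j) ∈ cellsOf l), i ≤ (T ⟨(i, j), h⟩ : ℕ) := by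
  intro i
  induction i with
  | zero => intro j h; exact Nat.zero_le _
  | succ i ih =>
    intro j h
    have h' : (i, j) ∈ cellsOf l := by
      rw [mem_cellsOf] at h ⊢
      obtain ⟨h1, h2⟩ := h
      simp only at h1 h2
      refine ⟨by simp only; omega, lt_of_lt_of_le h2 (hl ?_)⟩
      rw [Fin.le_def]; simp
    have h1 := ih j h'
    have h2 := hT.2 ⟨(i, j), h'⟩ ⟨(i + 1, j), h⟩ (by simp) rfl
    rw [Fin.lt_def] at h2
    omega

theorem exists_restrict {n : ℕ} {l : Fin (n + 1) → ℕ} (hl : Antitone l)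
    (T : cellsOf l → Fin (n + 1)) (hT : IsSsyt (cellsOf l) T) :
    ∃ k ∈ box l, ∃ T' : cellsOf k → Fin n, IsSsyt (cellsOf k) T' ∧
      extT (cellsOf l) (cellsOf k) T' = T := by
  have hcut : ∀ i : Fin n, ∃ k ≤ l i.castSucc, ∀ j < l i.castSucc,
      ((∃ h : ((i : ℕ), j) ∈ cellsOf l, T ⟨_, h⟩ ≠ Fin.last n) ↔ j < k) := by
    intro i
    apply exists_cut
    rintro j j' hjj hj' ⟨h, hlt⟩
    have h' : ((i : ℕ), j) ∈ cellsOf l := (mk_mem_cellsOf l i.castSucc j).2 (by omega)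
    refine ⟨h', fun e => hlt ?_⟩
    have := hT.1 ⟨_, h'⟩ ⟨_, h⟩ rfl hjj
    rw [e] at this
    exact Fin.last_le_iff.1 this
  choose k hk1 hk2 using hcut
  have hkb : k ∈ box l := by
    rw [mem_box]
    intro i
    refine ⟨?_, hk1 i⟩
    by_contra hlt
    push Not at hlt
    have hle := hl (Fin.castSucc_le_succ i)
    have h1 : ((i : ℕ), k i) ∈ cellsOf l := (mk_mem_cellsOf l i.castSucc _).2 (by omega)
    have h2 : ((i : ℕ) + 1, k i) ∈ cellsOf l := (mk_mem_cellsOf l i.succ _).2 hlt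
    have h3 := (hk2 i (k i) (by omega)).1 ⟨h1, by
      have := hT.2 ⟨_, h1⟩ ⟨_, h2⟩ (by simp) rfl
      exact (lt_of_lt_of_le this (Fin.le_last _)).ne⟩
    omega
  have hmem : ∀ c (hc : c ∈ cellsOf l), T ⟨c, hc⟩ ≠ Fin.last n ↔ c ∈ cellsOf k := by
    rintro ⟨i, j⟩ hc
    by_cases hi : i < n
    · have h1 := hk2 ⟨i, hi⟩ j ((mk_mem_cellsOf l (Fin.castSucc ⟨i, hi⟩) j).1 hc)
      have h2 := mk_mem_cellsOf k ⟨i, hi⟩ j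
      simp only at h1 h2
      rw [h2, ← h1]
      exact ⟨fun h => ⟨hc, h⟩, fun ⟨_, h⟩ => h⟩
    · have h1 := ssyt_row_le hl T hT i j hc
      constructor
      · intro h
        exfalso
        apply h
        rw [← Fin.last_le_iff, Fin.le_def]
        simp only [Fin.val_last]
        omega
      · intro h
        rw [mem_cellsOf] at h
        exact absurd h.1 hi
  refine ⟨k, hkb, fun c => (T ⟨c, cellsOf_subset hkb c.2⟩).castPred ((hmem _ _).2 c.2), ?_, ?_⟩
  · constructor
    · intro c c' h1 h2
      rw [Fin.castPred_le_castPred_iff]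
      exact hT.1 _ _ h1 h2
    · intro c c' h1 h2
      rw [Fin.castPred_lt_castPred_iff]
      exact hT.2 _ _ h1 h2
  · funext c
    by_cases h : (c : ℕ × ℕ) ∈ cellsOf k
    · rw [extT_mem _ c h, Fin.castSucc_castPred]
    · rw [extT_not_mem _ c h]
      by_contra hne
      exact h ((hmem c c.2).1 (Ne.symm hne))

theorem sgen_eq_S (a : ℤ → A) : ∀ (n : ℕ) (x : Fin n → A) (l : Fin n → ℕ), Antitone l →
    sgen n (cellsOf l) x a = S a n x l := by
  classical
  intro n
  induction n with
  | zero =>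
    intro x l _
    have he : ∀ c : cellsOf l, False := by
      rintro ⟨c, hc⟩
      rw [mem_cellsOf] at hc
      obtain ⟨h, _⟩ := hc
      omega
    have : IsEmpty (cellsOf l) := ⟨he⟩
    rw [sgen_eq_sum, S, Finset.filter_true_of_mem]
    · simp
    · intro T _
      exact ⟨fun c => (he c).elim, fun c => (he c).elim⟩
  | succ n ih =>
    intro x l hl
    have h1 : S a (n + 1) x l = ∑ k ∈ box l, ∑ T ∈ (Finset.univ : Finset (cellsOf k → Fin n)).filter
        (fun T => IsSsyt (cellsOf k) T), wt (x (Fin.last n)) a l k *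
        ∏ c : cellsOf k, (x (T c).castSucc -
          a ((T c : ℤ) + 1 + ((c : ℕ × ℕ).2 : ℤ) - ((c : ℕ × ℕ).1 : ℤ))) := by
      rw [S]
      apply Finset.sum_congr rfl
      intro k hk
      rw [← ih _ k (box_antitone hk), sgen_eq_sum, Finset.mul_sum]
    rw [h1, Finset.sum_sigma', sgen_eq_sum]
    symm
    refine Finset.sum_bij (fun p _ => extT (cellsOf l) (cellsOf p.1) p.2) ?_ ?_ ?_ ?_
    · rintro ⟨k, T⟩ hp
      simp only [Finset.mem_sigma, Finset.mem_filter, Finset.mem_univ, true_and] at hp ⊢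
      exact isSsyt_extT hl hp.1 T hp.2
    · rintro ⟨k, T⟩ hp ⟨k', T'⟩ hp' h
      simp only [Finset.mem_sigma, Finset.mem_filter, Finset.mem_univ, true_and] at hp hp' h
      have hkk : k = k' := by
        apply cellsOf_inj
        ext c
        by_cases hc : c ∈ cellsOf l
        · have e1 := extT_eq_last_iff T ⟨c, hc⟩
          have e2 := extT_eq_last_iff T' ⟨c, hc⟩
          rw [h] at e1
          simp only at e1 e2
          tauto
        · have := fun h => hc (cellsOf_subset hp.1 h)
          have := fun h => hc (cellsOf_subset hp'.1 h)
          tauto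
      subst hkk
      congr 1
      funext c
      have := congrFun h ⟨c, cellsOf_subset hp.1 c.2⟩
      rw [extT_mem T ⟨c, cellsOf_subset hp.1 c.2⟩ c.2,
        extT_mem T' ⟨c, cellsOf_subset hp.1 c.2⟩ c.2] at this
      exact Fin.castSucc_injective _ this
    · intro T hT
      simp only [Finset.mem_filter, Finset.mem_univ, true_and] at hT
      obtain ⟨k, hk, T', hT', he⟩ := exists_restrict hl T hT
      exact ⟨⟨k, T'⟩, by simp [hk, hT'], he⟩
    · rintro ⟨k, T⟩ hp
      simp only [Finset.mem_sigma, Finset.mem_filter, Finset.mem_univ, true_and] at hp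
      have hsub := cellsOf_subset hp.1
      simp only
      set g : ℕ × ℕ → A := fun c => if h : c ∈ cellsOf l then
        (x (extT (cellsOf l) (cellsOf k) T ⟨c, h⟩) -
          a (((extT (cellsOf l) (cellsOf k) T ⟨c, h⟩ : ℕ) : ℤ) + 1 + (c.2 : ℤ) - (c.1 : ℤ))) else 0
        with hg
      have hg1 : ∏ c ∈ cellsOf l, g c = ∏ c : cellsOf l, (x (extT (cellsOf l) (cellsOf k) T c) -
          a (((extT (cellsOf l) (cellsOf k) T c : ℕ) : ℤ) + 1 + ((c : ℕ × ℕ).2 : ℤ)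
            - ((c : ℕ × ℕ).1 : ℤ))) := by
        rw [← Finset.prod_coe_sort]
        apply Finset.prod_congr rfl
        intro c _
        simp [hg]
      rw [← hg1, ← Finset.prod_sdiff hsub, wt]
      congr 1
      · apply Finset.prod_congr rfl
        intro c hc
        rw [Finset.mem_sdiff] at hc
        simp only [hg, hc.1, dite_true]
        rw [extT_not_mem T ⟨c, hc.1⟩ hc.2]
        simp
      · rw [← Finset.prod_coe_sort (cellsOf k) g]
        apply Finset.prod_congr rfl
        intro c _
        simp only [hg, hsub c.2, dite_true]
        rw [extT_mem T ⟨c, hsub c.2⟩ c.2]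
        simp

theorem sgen_oneBox (n : ℕ) (x : Fin n → A) (a : ℤ → A) :
    sgen n oneBox.cells x a = ∑ i : Fin n, (x i - a ((i : ℤ) + 1)) := by
  classical
  have hm : ((0, 0) : ℕ × ℕ) ∈ oneBox.cells := by simp [oneBox]
  have hc : ∀ c : oneBox.cells, c = ⟨(0, 0), hm⟩ := by
    rintro ⟨c, h⟩
    apply Subtype.ext
    simpa [oneBox] using h
  rw [sgen_eq_sum, Finset.filter_true_of_mem]
  · refine Finset.sum_bij (fun T _ => T ⟨(0, 0), hm⟩) ?_ ?_ ?_ ?_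
    · simp
    · intro T _ T' _ h
      funext c
      rw [hc c]; exact h
    · intro i _
      exact ⟨fun _ => i, Finset.mem_univ _, rfl⟩
    · intro T _
      rw [Finset.prod_eq_single ⟨(0, 0), hm⟩]
      · simp
      · intro c _ h; exact absurd (hc c) h
      · simp
  · intro T _
    refine ⟨fun c c' _ _ => by rw [hc c, hc c'], fun c c' h _ => ?_⟩
    rw [hc c, hc c'] at h
    simp at h

/-- Row lengths. -/
def rows (n : ℕ) (mu : YoungDiagram) : Fin n → ℕ := fun i => mu.rowLen i

theorem rows_antitone (n : ℕ) (mu : YoungDiagram) : Antitone (rows n mu) :=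
  fun i j h => mu.rowLen_anti i j h

theorem cells_eq (n : ℕ) (mu : YoungDiagram) (h : mu.colLen 0 ≤ n) :
    mu.cells = cellsOf (rows n mu) := by
  ext ⟨i, j⟩
  rw [mem_cellsOf, YoungDiagram.mem_cells]
  simp only [rows]
  rw [← YoungDiagram.mem_iff_lt_rowLen]
  constructor
  · intro hm
    refine ⟨?_, hm⟩
    have : (i, 0) ∈ mu := mu.up_left_mem le_rfl (Nat.zero_le _) hm
    rw [YoungDiagram.mem_iff_lt_colLen] at this
    omega
  · exact fun h => h.2

/-- The Young diagram with given rows. -/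
def ydOf {n : ℕ} (l : Fin n → ℕ) (hl : Antitone l) : YoungDiagram :=
  ⟨cellsOf l, by
    rintro ⟨i, j⟩ ⟨i', j'⟩ h hc
    rw [Finset.mem_coe, mem_cellsOf] at hc ⊢
    obtain ⟨h1, h2⟩ := hc
    obtain ⟨h3, h4⟩ := h
    simp only at h1 h2 h3 h4
    refine ⟨by simp only; omega, ?_⟩
    exact lt_of_le_of_lt h4 (lt_of_lt_of_le h2 (hl h3))⟩

theorem rows_ydOf {n : ℕ} (l : Fin n → ℕ) (hl : Antitone l) : rows n (ydOf l hl) = l := by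
  funext i
  have h : ∀ j, j < rows n (ydOf l hl) i ↔ j < l i := fun j => by
    rw [← mk_mem_cellsOf l, rows, ← YoungDiagram.mem_iff_lt_rowLen]
    rfl
  have h1 := h (l i)
  have h2 := h (rows n (ydOf l hl) i)
  omega

theorem colLen_ydOf {n : ℕ} (l : Fin n → ℕ) (hl : Antitone l) : (ydOf l hl).colLen 0 ≤ n := by
  by_contra h
  push Not at h
  rw [← YoungDiagram.mem_iff_lt_colLen] at h
  have : (n, 0) ∈ cellsOf l := h
  rw [mem_cellsOf] at this
  obtain ⟨h, _⟩ := this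
  simp at h

theorem rows_of_covers {n : ℕ} {mu rho : YoungDiagram} (hmu : mu.colLen 0 ≤ n)
    (h : Covers mu rho) (hr : rho.colLen 0 ≤ n) : ∃ i, rows n rho = up (rows n mu) i := by
  obtain ⟨⟨r, c⟩, hc, he⟩ := Finset.exists_eq_insert_iff.2
    ⟨YoungDiagram.cells_subset_iff.2 h.1, h.2.symm⟩
  rw [cells_eq n mu hmu, cells_eq n rho hr] at *
  have hm : (r, c) ∈ cellsOf (rows n rho) := by rw [← he]; simp
  have hrn := ((mem_cellsOf _ _).1 hm).1
  simp only at hrn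
  refine ⟨⟨r, hrn⟩, ?_⟩
  have hin : ∀ (i : Fin n) (j : ℕ), j < rows n rho i ↔
      (((i : ℕ), j) = (r, c) ∨ j < rows n mu i) := by
    intro i j
    rw [← mk_mem_cellsOf, ← mk_mem_cellsOf, ← he, Finset.mem_insert]
  have hc' : ¬ c < rows n mu ⟨r, hrn⟩ := fun h => hc ((mk_mem_cellsOf _ ⟨r, hrn⟩ c).2 h)
  funext i
  by_cases hi : i = ⟨r, hrn⟩
  · subst hi
    rw [up_same]
    have h1 := hin ⟨r, hrn⟩ (rows n mu ⟨r, hrn⟩)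
    have h2 := hin ⟨r, hrn⟩ c
    have h3 := hin ⟨r, hrn⟩ (c + 1)
    simp only [Prod.mk.injEq, eq_self_iff_true, true_and, true_or, iff_true] at h1 h2 h3
    omega
  · rw [up_ne _ hi]
    have hne : (i : ℕ) ≠ r := fun e => hi (Fin.ext e)
    have h1 := hin i (rows n mu i)
    have h2 := hin i (rows n rho i)
    simp only [Prod.mk.injEq, hne, false_and, false_or] at h1 h2
    omega

theorem sum_covers (n : ℕ) (x : Fin n → A) (a : ℤ → A) (mu : YoungDiagram)
    (hmu : mu.colLen 0 ≤ n) :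
    ∑ᶠ rho ∈ {rho : YoungDiagram | Covers mu rho ∧ rho.colLen 0 ≤ n}, sgen n rho.cells x a =
      ∑ i : Fin n, S a n x (up (rows n mu) i) := by
  classical
  have h0 : ∑ i : Fin n, S a n x (up (rows n mu) i) =
      ∑ i ∈ Finset.univ.filter (fun i : Fin n => Antitone (up (rows n mu) i)),
        S a n x (up (rows n mu) i) := by
    symm
    apply Finset.sum_subset (Finset.filter_subset _ _)
    intro i _ hi
    simp only [Finset.mem_filter, Finset.mem_univ, true_and] at hi
    cases n with
    | zero => exact i.elim0
    | succ n =>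
      rw [Fin.antitone_iff_succ_le] at hi
      push Not at hi
      obtain ⟨j, hj⟩ := hi
      exact S_zero_of_lt a x _ j.castSucc j.succ (by simp) hj
  have hinj : Function.Injective (up (rows n mu)) := by
    intro i j h
    by_contra hij
    have := congrFun h i
    rw [up_same, up_ne _ hij] at this
    omega
  rw [h0, ← Finset.sum_image (f := S a n x) (g := up (rows n mu)) (fun i _ j _ h => hinj h),
    ← finsum_mem_coe_finset]
  refine finsum_mem_eq_of_bijOn (rows n) ⟨?_, ?_, ?_⟩ ?_
  · rintro rho ⟨h1, h2⟩
    obtain ⟨i, hi⟩ := rows_of_covers hmu h1 h2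
    simp only [Finset.coe_image, Set.mem_image, Finset.mem_coe, Finset.mem_filter,
      Finset.mem_univ, true_and]
    exact ⟨i, hi ▸ rows_antitone n rho, hi.symm⟩
  · rintro rho ⟨h1, h2⟩ rho' ⟨h1', h2'⟩ h
    apply YoungDiagram.ext
    rw [cells_eq n rho h2, cells_eq n rho' h2', h]
  · intro l hl
    simp only [Finset.coe_image, Set.mem_image, Finset.mem_coe, Finset.mem_filter,
      Finset.mem_univ, true_and] at hl
    obtain ⟨i, hi, rfl⟩ := hl
    refine ⟨ydOf _ hi, ⟨?_, colLen_ydOf _ hi⟩, rows_ydOf _ hi⟩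
    have := Finset.exists_eq_insert_iff.1 ⟨((i : ℕ), rows n mu i), by
      simp [mk_mem_cellsOf], (cellsOf_up (rows n mu) i).symm⟩
    rw [← cells_eq n mu hmu] at this
    exact ⟨YoungDiagram.cells_subset_iff.1 this.1, this.2.symm⟩
  · rintro rho ⟨h1, h2⟩
    rw [cells_eq n rho h2, sgen_eq_S _ _ _ _ (rows_antitone n rho)]

end tableaux

/-- **Pieri-type rule.**
`s_{(1)}(x|a)·s_μ(x|a) = s_{(1)}(a_μ|a)·s_μ(x|a) + Σ_{μ → ρ, l(ρ) ≤ n} s_ρ(x|a)`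
in `ℤ[a_i : i ∈ ℤ][x_1,…,x_n]`, where `s_{(1)}(a_μ|a) = Σ_{i=1}^n (a_{μ_i+n−i+1} − a_i)`. -/
theorem pieri_oneBox (n : ℕ) (hn : 1 ≤ n) (mu : YoungDiagram) (hmu : mu.colLen 0 ≤ n) :
    sgen n oneBox.cells
        (fun i => (MvPolynomial.X (Sum.inr i) : MvPolynomial (ℤ ⊕ Fin n) ℤ))
        (fun k => MvPolynomial.X (Sum.inl k)) *
      sgen n mu.cells (fun i => MvPolynomial.X (Sum.inr i))
        (fun k => MvPolynomial.X (Sum.inl k)) =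
    (∑ i : Fin n,
        (subA n (fun k => (MvPolynomial.X (Sum.inl k) : MvPolynomial (ℤ ⊕ Fin n) ℤ)) mu i
          - MvPolynomial.X (Sum.inl ((i : ℤ) + 1)))) *
      sgen n mu.cells (fun i => MvPolynomial.X (Sum.inr i))
        (fun k => MvPolynomial.X (Sum.inl k)) +
    ∑ᶠ rho ∈ {rho : YoungDiagram | Covers mu rho ∧ rho.colLen 0 ≤ n},
      sgen n rho.cells (fun i => MvPolynomial.X (Sum.inr i))
        (fun k => MvPolynomial.X (Sum.inl k)) := by
  rw [sum_covers n _ _ mu hmu, sgen_oneBox, cells_eq n mu hmu,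
    sgen_eq_S _ _ _ _ (rows_antitone n mu), ← pieri_S _ _ _ _ (rows_antitone n mu), ← add_mul,
    ← Finset.sum_add_distrib]
  congr 1
  apply Finset.sum_congr rfl
  intro i _
  simp only [subA, rows]
  ring

end FactorialLR
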